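/- arXiv:1507.03689 — 8 statements merged into one kernel-verified Lean document; each statement's English description precedes it below -/
import Mathlib

section
/- Given a Zappa–Szép system (𝒢, 𝒣, ·, |), the Zappa–Szép product 𝒢⋈𝒣 with the given multiplication and inversion is a groupoid: the multiplication is associative where defined, ((g,h)⁻¹)⁻¹ = (g,h), (g,h)(g,h)⁻¹ = (b(g), b(g)) and (g,h)⁻¹(g,h) = (r(h), r(h)) (where (u,u) denotes the pair of identity arrows at the object u); in particular the identity arrows of 𝒢⋈𝒣 are exactly the pairs (u,u) for u ∈ 𝒰, so the unit space of 𝒢⋈𝒣 is identified with 𝒰. -/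
/-- An (algebraic) groupoid with object set `U`: a set of arrows `Arr`, each with a
source and a range in `U`, an identity arrow at each object, a multiplication
(total as a function, but only constrained on composable pairs, i.e. when the
source of the first arrow equals the range of the second) and inversion. -/
structure GroupoidOn (U : Type*) where
  Arr : Type*
  src : Arr → U
  rng : Arr → U
  unit : U → Arr
  mul : Arr → Arr → Arr
  inv : Arr → Arr
  src_unit : ∀ u, src (unit u) = u
  rng_unit : ∀ u, rng (unit u) = u
  rng_mul : ∀ g₁ g₂, src g₁ = rng g₂ → rng (mul g₁ g₂) = rng g₁
  src_mul : ∀ g₁ g₂, src g₁ = rng g₂ → src (mul g₁ g₂) = src g₂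
  src_inv : ∀ g, src (inv g) = rng g
  rng_inv : ∀ g, rng (inv g) = src g
  mul_assoc : ∀ g₁ g₂ g₃, src g₁ = rng g₂ → src g₂ = rng g₃ →
    mul (mul g₁ g₂) g₃ = mul g₁ (mul g₂ g₃)
  unit_mul : ∀ g, mul (unit (rng g)) g = g
  mul_unit : ∀ g, mul g (unit (src g)) = g
  mul_inv : ∀ g, mul g (inv g) = unit (rng g)
  inv_mul : ∀ g, mul (inv g) g = unit (src g)

/-- A Zappa–Szép system on a pair of groupoids `G`, `H` with the same object set `U`.
For an arrow `g` of `G`, `b g := G.rng g` and `t g := G.src g`; for an arrow `h` of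
`H`, `l h := H.rng h` and `r h := H.src h`.  The action `act h g` and restriction
`res h g` are constrained only for pairs with `r h = b g`, and satisfy (ZS1)–(ZS9). -/
structure ZSSystem {U : Type*} (G H : GroupoidOn U) where
  act : H.Arr → G.Arr → G.Arr
  res : H.Arr → G.Arr → H.Arr
  zs1 : ∀ h₁ h₂ g, H.src h₁ = H.rng h₂ → H.src h₂ = G.rng g →
      act (H.mul h₁ h₂) g = act h₁ (act h₂ g)
  zs2 : ∀ h g₁ g₂, H.src h = G.rng g₁ → G.src g₁ = G.rng g₂ →
      act h (G.mul g₁ g₂) = G.mul (act h g₁) (act (res h g₁) g₂)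
  zs3 : ∀ h g₁ g₂, H.src h = G.rng g₁ → G.src g₁ = G.rng g₂ →
      res h (G.mul g₁ g₂) = res (res h g₁) g₂
  zs4 : ∀ h₁ h₂ g, H.src h₁ = H.rng h₂ → H.src h₂ = G.rng g →
      res (H.mul h₁ h₂) g = H.mul (res h₁ (act h₂ g)) (res h₂ g)
  zs5 : ∀ h g, H.src h = G.rng g → G.rng (act h g) = H.rng h
  zs6 : ∀ h g, H.src h = G.rng g → H.src (res h g) = G.src g
  zs7 : ∀ h g, H.src h = G.rng g → G.src (act h g) = H.rng (res h g)
  zs8 : ∀ g, act (H.unit (G.rng g)) g = g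
  zs9 : ∀ h, res h (G.unit (H.src h)) = h

/-- Membership in the Zappa–Szép product `G ⋈ H`: a pair `(g,h)` belongs to `G ⋈ H`
exactly when `t(g) = l(h)`. -/
def zsMem {U : Type*} (G H : GroupoidOn U) (p : G.Arr × H.Arr) : Prop :=
  G.src p.1 = H.rng p.2

/-- The multiplication of the Zappa–Szép product:
`(g₁,h₁)(g₂,h₂) = (g₁(h₁·g₂), (h₁|_{g₂})h₂)` (defined when `r(h₁) = b(g₂)`). -/
def zsMul {U : Type*} {G H : GroupoidOn U} (Z : ZSSystem G H)
    (p q : G.Arr × H.Arr) : G.Arr × H.Arr :=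
  (G.mul p.1 (Z.act p.2 q.1), H.mul (Z.res p.2 q.1) q.2)

/-- The inversion of the Zappa–Szép product: `(g,h)⁻¹ = (h⁻¹·g⁻¹, h⁻¹|_{g⁻¹})`. -/
def zsInv {U : Type*} {G H : GroupoidOn U} (Z : ZSSystem G H)
    (p : G.Arr × H.Arr) : G.Arr × H.Arr :=
  (Z.act (H.inv p.2) (G.inv p.1), Z.res (H.inv p.2) (G.inv p.1))

namespace GroupoidOn

variable {U : Type*} (G : GroupoidOn U)

theorem eq_unit_of_mul_self {a : G.Arr} (hs : G.src a = G.rng a) (ha : G.mul a a = a) :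
    a = G.unit (G.rng a) := by
  have h := G.mul_assoc (G.inv a) a a (G.src_inv a) hs
  rw [ha, G.inv_mul, hs, G.unit_mul] at h
  exact h

theorem unit_mul_of_eq {u : U} {g : G.Arr} (h : u = G.rng g) : G.mul (G.unit u) g = g := by
  rw [h, G.unit_mul]

theorem mul_unit_of_eq {u : U} {g : G.Arr} (h : u = G.src g) : G.mul g (G.unit u) = g := by
  rw [h, G.mul_unit]

end GroupoidOn

namespace ZSSystem

variable {U : Type*} {G H : GroupoidOn U} (Z : ZSSystem G H)

theorem unit_act {u : U} {g : G.Arr} (hu : u = G.rng g) : Z.act (H.unit u) g = g := by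
  rw [hu, Z.zs8]

theorem res_unit {h : H.Arr} {u : U} (hu : H.src h = u) : Z.res h (G.unit u) = h := by
  rw [← hu, Z.zs9]

theorem act_unit {h : H.Arr} {u : U} (hu : H.src h = u) :
    Z.act h (G.unit u) = G.unit (H.rng h) := by
  have hb : H.src h = G.rng (G.unit u) := by rw [G.rng_unit, hu]
  have hm : G.mul (G.unit u) (G.unit u) = G.unit u := G.unit_mul_of_eq (G.rng_unit u).symm
  have h2 := Z.zs2 h (G.unit u) (G.unit u) hb (by rw [G.src_unit, G.rng_unit])
  rw [hm, Z.res_unit hu] at h2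
  have h5 := Z.zs5 h _ hb
  have h7 := Z.zs7 h _ hb
  rw [Z.res_unit hu] at h7
  rw [← h5]
  exact G.eq_unit_of_mul_self (h7.trans h5.symm) h2.symm

theorem unit_res {g : G.Arr} {u : U} (hu : u = G.rng g) :
    Z.res (H.unit u) g = H.unit (G.src g) := by
  have hb : H.src (H.unit u) = G.rng g := by rw [H.src_unit, hu]
  have hm : H.mul (H.unit u) (H.unit u) = H.unit u := H.unit_mul_of_eq (H.rng_unit u).symm
  have h4 := Z.zs4 (H.unit u) (H.unit u) g (by rw [H.src_unit, H.rng_unit]) hb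
  rw [hm, Z.unit_act hu] at h4
  have h6 := Z.zs6 _ g hb
  have h7 := Z.zs7 _ g hb
  rw [Z.unit_act hu] at h7
  rw [h7]
  exact H.eq_unit_of_mul_self (h6.trans h7) h4.symm

end ZSSystem

section ZappaSzepProduct

variable {U : Type*} {G H : GroupoidOn U} (Z : ZSSystem G H)

theorem rng_zsMul {p q : G.Arr × H.Arr} (hp : zsMem G H p) (h : H.src p.2 = G.rng q.1) :
    G.rng (zsMul Z p q).1 = G.rng p.1 :=
  G.rng_mul _ _ (hp.trans (Z.zs5 _ _ h).symm)

theorem src_zsMul {p q : G.Arr × H.Arr} (hq : zsMem G H q) (h : H.src p.2 = G.rng q.1) :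
    H.src (zsMul Z p q).2 = H.src q.2 :=
  H.src_mul _ _ ((Z.zs6 _ _ h).trans hq)

theorem zsMem_zsMul {p q : G.Arr × H.Arr} (hp : zsMem G H p) (hq : zsMem G H q)
    (h : H.src p.2 = G.rng q.1) : zsMem G H (zsMul Z p q) :=
  (G.src_mul _ _ (hp.trans (Z.zs5 _ _ h).symm)).trans
    ((Z.zs7 _ _ h).trans (H.rng_mul _ _ ((Z.zs6 _ _ h).trans hq)).symm)

theorem src_inv_eq_rng_inv {p : G.Arr × H.Arr} (hp : zsMem G H p) :
    H.src (H.inv p.2) = G.rng (G.inv p.1) := by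
  rw [H.src_inv, G.rng_inv]
  exact hp.symm

theorem rng_zsInv {p : G.Arr × H.Arr} (hp : zsMem G H p) :
    G.rng (zsInv Z p).1 = H.src p.2 :=
  (Z.zs5 _ _ (src_inv_eq_rng_inv hp)).trans (H.rng_inv _)

theorem src_zsInv {p : G.Arr × H.Arr} (hp : zsMem G H p) :
    H.src (zsInv Z p).2 = G.rng p.1 :=
  (Z.zs6 _ _ (src_inv_eq_rng_inv hp)).trans (G.src_inv _)

theorem zsMem_zsInv {p : G.Arr × H.Arr} (hp : zsMem G H p) : zsMem G H (zsInv Z p) :=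
  Z.zs7 _ _ (src_inv_eq_rng_inv hp)

theorem zsMul_assoc {p q r : G.Arr × H.Arr} (hp : zsMem G H p) (hq : zsMem G H q)
    (hr : zsMem G H r) (hpq : H.src p.2 = G.rng q.1) (hqr : H.src q.2 = G.rng r.1) :
    zsMul Z (zsMul Z p q) r = zsMul Z p (zsMul Z q r) := by
  obtain ⟨g₁, h₁⟩ := p
  obtain ⟨g₂, h₂⟩ := q
  obtain ⟨g₃, h₃⟩ := r
  simp only [zsMem, zsMul] at *
  have hres : H.src (Z.res h₁ g₂) = H.rng h₂ := (Z.zs6 _ _ hpq).trans hq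
  have hact : G.src g₂ = G.rng (Z.act h₂ g₃) := hq.trans (Z.zs5 _ _ hqr).symm
  have hra : H.src (Z.res h₁ g₂) = G.rng (Z.act h₂ g₃) := (Z.zs6 _ _ hpq).trans hact
  ext
  · rw [Z.zs2 _ _ _ hpq hact, Z.zs1 _ _ _ hres hqr]
    exact G.mul_assoc _ _ _ (hp.trans (Z.zs5 _ _ hpq).symm)
      ((Z.zs7 _ _ hpq).trans (Z.zs5 _ _ hra).symm)
  · rw [Z.zs3 _ _ _ hpq hact, Z.zs4 _ _ _ hres hqr]
    exact H.mul_assoc _ _ _ ((Z.zs6 _ _ hra).trans (Z.zs7 _ _ hqr))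
      ((Z.zs6 _ _ hqr).trans hr)

theorem zsMul_zsInv {p : G.Arr × H.Arr} (hp : zsMem G H p) :
    zsMul Z p (zsInv Z p) = (G.unit (G.rng p.1), H.unit (G.rng p.1)) := by
  have hi := src_inv_eq_rng_inv hp
  have hc : H.src p.2 = H.rng (H.inv p.2) := (H.rng_inv _).symm
  have hu : H.rng p.2 = G.rng (G.inv p.1) := by rw [G.rng_inv]; exact hp.symm
  simp only [zsMul, zsInv]
  rw [← Z.zs1 _ _ _ hc hi, ← Z.zs4 _ _ _ hc hi, H.mul_inv, Z.unit_act hu, Z.unit_res hu,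
    G.mul_inv, G.src_inv]

theorem zsInv_zsMul {p : G.Arr × H.Arr} (hp : zsMem G H p) :
    zsMul Z (zsInv Z p) p = (G.unit (H.src p.2), H.unit (H.src p.2)) := by
  have hi := src_inv_eq_rng_inv hp
  have hc : G.src (G.inv p.1) = G.rng p.1 := G.src_inv _
  have hu : H.src (H.inv p.2) = G.src p.1 := (H.src_inv _).trans hp.symm
  simp only [zsMul, zsInv]
  rw [← Z.zs2 _ _ _ hi hc, ← Z.zs3 _ _ _ hi hc, G.inv_mul, Z.act_unit hu, Z.res_unit hu,
    H.inv_mul, H.rng_inv]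

theorem unit_zsMul {p : G.Arr × H.Arr} (hp : zsMem G H p) :
    zsMul Z (G.unit (G.rng p.1), H.unit (G.rng p.1)) p = p := by
  simp only [zsMul]
  rw [Z.unit_act rfl, Z.unit_res rfl, G.unit_mul, H.unit_mul_of_eq hp]

theorem zsMul_unit {p : G.Arr × H.Arr} (hp : zsMem G H p) :
    zsMul Z p (G.unit (H.src p.2), H.unit (H.src p.2)) = p := by
  simp only [zsMul]
  rw [Z.act_unit rfl, Z.res_unit rfl, H.mul_unit, G.mul_unit_of_eq hp.symm]

theorem zsInv_zsInv {p : G.Arr × H.Arr} (hp : zsMem G H p) : zsInv Z (zsInv Z p) = p := by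
  have hq := zsMem_zsInv Z hp
  have hassoc := zsMul_assoc Z hp hq (zsMem_zsInv Z hq) (rng_zsInv Z hp).symm (rng_zsInv Z hq).symm
  rw [zsMul_zsInv Z hp, zsMul_zsInv Z hq, rng_zsInv Z hp, zsMul_unit Z hp, ← src_zsInv Z hp,
    ← rng_zsInv Z hq, unit_zsMul Z (zsMem_zsInv Z hq)] at hassoc
  exact hassoc

theorem zsMem_unit (u : U) : zsMem G H (G.unit u, H.unit u) :=
  (G.src_unit u).trans (H.rng_unit u).symm

end ZappaSzepProduct

/-- The Zappa–Szép product `G ⋈ H` of a Zappa–Szép system, with the given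
multiplication and inversion, is a groupoid: the product of composable elements of
`G ⋈ H` again lies in `G ⋈ H` and has the expected range and source; `G ⋈ H` is closed
under inversion; the multiplication is associative where defined; `((g,h)⁻¹)⁻¹ = (g,h)`;
`(g,h)(g,h)⁻¹ = (b(g), b(g))` and `(g,h)⁻¹(g,h) = (r(h), r(h))`; and the identity arrows
of `G ⋈ H` are exactly the pairs `(u,u)` of identity arrows at objects `u`, so the unit
space of `G ⋈ H` is identified with `U`. -/
theorem zs_product_is_groupoid {U : Type*} (G H : GroupoidOn U) (Z : ZSSystem G H) :
    -- closure under multiplication, with the expected range and source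
    (∀ p q, zsMem G H p → zsMem G H q → H.src p.2 = G.rng q.1 →
      zsMem G H (zsMul Z p q) ∧ G.rng (zsMul Z p q).1 = G.rng p.1 ∧
        H.src (zsMul Z p q).2 = H.src q.2)
    -- closure under inversion
    ∧ (∀ p, zsMem G H p → zsMem G H (zsInv Z p))
    -- associativity
    ∧ (∀ p q r, zsMem G H p → zsMem G H q → zsMem G H r →
        H.src p.2 = G.rng q.1 → H.src q.2 = G.rng r.1 →
        zsMul Z (zsMul Z p q) r = zsMul Z p (zsMul Z q r))
    -- inversion is involutive
    ∧ (∀ p, zsMem G H p → zsInv Z (zsInv Z p) = p)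
    -- (g,h)(g,h)⁻¹ = (b(g), b(g))
    ∧ (∀ p, zsMem G H p →
        zsMul Z p (zsInv Z p) = (G.unit (G.rng p.1), H.unit (G.rng p.1)))
    -- (g,h)⁻¹(g,h) = (r(h), r(h))
    ∧ (∀ p, zsMem G H p →
        zsMul Z (zsInv Z p) p = (G.unit (H.src p.2), H.unit (H.src p.2)))
    -- every pair (u,u) of identity arrows lies in G ⋈ H ...
    ∧ (∀ u, zsMem G H (G.unit u, H.unit u))
    -- ... and is a left and right identity for the multiplication
    ∧ (∀ p, zsMem G H p → zsMul Z (G.unit (G.rng p.1), H.unit (G.rng p.1)) p = p)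
    ∧ (∀ p, zsMem G H p → zsMul Z p (G.unit (H.src p.2), H.unit (H.src p.2)) = p)
    -- the identity arrows of G ⋈ H are exactly the pairs (u,u)
    ∧ (∀ p, zsMem G H p →
        ((∃ u, p = (G.unit u, H.unit u)) ↔ zsMul Z p (zsInv Z p) = p)) := by
  refine ⟨fun p q hp hq h => ⟨zsMem_zsMul Z hp hq h, rng_zsMul Z hp h, src_zsMul Z hq h⟩,
    fun p hp => zsMem_zsInv Z hp, fun p q r hp hq hr => zsMul_assoc Z hp hq hr,
    fun p hp => zsInv_zsInv Z hp, fun p hp => zsMul_zsInv Z hp,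
    fun p hp => zsInv_zsMul Z hp, zsMem_unit, fun p hp => unit_zsMul Z hp,
    fun p hp => zsMul_unit Z hp, fun p hp => ?_⟩
  rw [zsMul_zsInv Z hp]
  constructor
  · rintro ⟨u, rfl⟩
    simp only [G.rng_unit]
  · exact fun h => ⟨G.rng p.1, h.symm⟩
end

section
/- Given a Zappa–Szép system (𝒢, 𝒣, ·, |), for every (g,h) ∈ 𝒢⋈𝒣 one has (g,h)(g,h)⁻¹ = (b(g), b(g)); equivalently, g(h·(h⁻¹·g⁻¹)) is the identity arrow of 𝒢 at b(g) and (h|_{h⁻¹·g⁻¹})(h⁻¹|_{g⁻¹}) is the identity arrow of 𝒣 at b(g). -/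
theorem GroupoidOn.eq_unit_of_mul_self_s7 {U : Type*} (H : GroupoidOn U) {x : H.Arr}
    (hx : H.src x = H.rng x) (hxx : H.mul x x = x) : x = H.unit (H.src x) := by
  have h := H.mul_assoc (H.inv x) x x (H.src_inv x) hx
  rwa [hxx, H.inv_mul, hx, H.unit_mul, ← hx] at h

theorem ZSSystem.res_unit_s7 {U : Type*} {G H : GroupoidOn U} (Z : ZSSystem G H) (g : G.Arr) :
    Z.res (H.unit (G.rng g)) g = H.unit (G.src g) := by
  have hs : H.src (H.unit (G.rng g)) = G.rng g := H.src_unit _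
  have hr : H.rng (H.unit (G.rng g)) = G.rng g := H.rng_unit _
  have hsrc := Z.zs6 _ g hs
  have hrng := Z.zs7 _ g hs
  have hmul := Z.zs4 _ _ g (hs.trans hr.symm) hs
  have hunit := H.unit_mul (H.unit (G.rng g))
  rw [hr] at hunit
  rw [Z.zs8] at hrng hmul
  rw [hunit] at hmul
  rw [← hsrc]
  exact H.eq_unit_of_mul_self_s7 (hsrc.trans hrng) hmul.symm

/-- For `(g,h) ∈ G ⋈ H` (that is, `t(g) = l(h)`) one has `(g,h)(g,h)⁻¹ = (b(g), b(g))`;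
equivalently, `g(h·(h⁻¹·g⁻¹))` is the identity arrow of `G` at `b(g)` and
`(h|_{h⁻¹·g⁻¹})(h⁻¹|_{g⁻¹})` is the identity arrow of `H` at `b(g)`. -/
theorem zs_mul_inv {U : Type*} (G H : GroupoidOn U) (Z : ZSSystem G H)
    (g : G.Arr) (h : H.Arr) (hm : G.src g = H.rng h) :
    G.mul g (Z.act h (Z.act (H.inv h) (G.inv g))) = G.unit (G.rng g)
    ∧ H.mul (Z.res h (Z.act (H.inv h) (G.inv g))) (Z.res (H.inv h) (G.inv g))
        = H.unit (G.rng g) := by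
  have hcomp : H.src h = H.rng (H.inv h) := (H.rng_inv h).symm
  have hinv : H.src (H.inv h) = G.rng (G.inv g) := by rw [H.src_inv, G.rng_inv, hm]
  have hunit : H.mul h (H.inv h) = H.unit (G.rng (G.inv g)) := by
    rw [H.mul_inv, G.rng_inv, hm]
  constructor
  · rw [← Z.zs1 _ _ _ hcomp hinv, hunit, Z.zs8, G.mul_inv]
  · rw [← Z.zs4 _ _ _ hcomp hinv, hunit, Z.res_unit_s7, G.src_inv]
end

section
/- Given a Zappa–Szép system (𝒢, 𝒣, ·, |), for every (g,h) ∈ 𝒢⋈𝒣 one has (g,h)⁻¹(g,h) = (r(h), r(h)); equivalently, (h⁻¹·g⁻¹)((h⁻¹|_{g⁻¹})·g) is the identity arrow of 𝒢 at r(h) and ((h⁻¹|_{g⁻¹})|_g)h is the identity arrow of 𝒣 at r(h). -/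
namespace GroupoidOn

/-- An idempotent loop in a groupoid is an identity arrow. -/
theorem eq_unit_of_mul_self_s8 {U : Type*} (G : GroupoidOn U) {e : G.Arr}
    (hloop : G.src e = G.rng e) (he : G.mul e e = e) : e = G.unit (G.rng e) := by
  have h := G.mul_assoc (G.inv e) e e (G.src_inv e) hloop
  rwa [he, G.inv_mul, hloop, G.unit_mul] at h

end GroupoidOn

namespace ZSSystem

/-- The action sends identity arrows to identity arrows. -/
theorem act_unit_s8 {U : Type*} {G H : GroupoidOn U} (Z : ZSSystem G H) (k : H.Arr) :
    Z.act k (G.unit (H.src k)) = G.unit (H.rng k) := by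
  have hk : H.src k = G.rng (G.unit (H.src k)) := (G.rng_unit _).symm
  have hu : G.src (G.unit (H.src k)) = G.rng (G.unit (H.src k)) := by
    rw [G.src_unit, G.rng_unit]
  have hrng := Z.zs5 k _ hk
  have hsrc := Z.zs7 k _ hk
  have hmul := Z.zs2 k _ _ hk hu
  have huu : G.mul (G.unit (H.src k)) (G.unit (H.src k)) = G.unit (H.src k) := by
    simpa only [G.src_unit] using G.mul_unit (G.unit (H.src k))
  rw [Z.zs9] at hsrc hmul
  rw [huu] at hmul
  rw [G.eq_unit_of_mul_self_s8 (hsrc.trans hrng.symm) hmul.symm, hrng]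

end ZSSystem

/-- For `(g,h) ∈ G ⋈ H` (that is, `t(g) = l(h)`) one has `(g,h)⁻¹(g,h) = (r(h), r(h))`;
equivalently, `(h⁻¹·g⁻¹)((h⁻¹|_{g⁻¹})·g)` is the identity arrow of `G` at `r(h)` and
`((h⁻¹|_{g⁻¹})|_g)h` is the identity arrow of `H` at `r(h)`. -/
theorem zs_inv_mul {U : Type*} (G H : GroupoidOn U) (Z : ZSSystem G H)
    (g : G.Arr) (h : H.Arr) (hm : G.src g = H.rng h) :
    G.mul (Z.act (H.inv h) (G.inv g)) (Z.act (Z.res (H.inv h) (G.inv g)) g)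
        = G.unit (H.src h)
    ∧ H.mul (Z.res (Z.res (H.inv h) (G.inv g)) g) h = H.unit (H.src h) := by
  have hk : H.src (H.inv h) = G.rng (G.inv g) := by
    rw [H.src_inv, G.rng_inv, hm]
  have hg : G.src g = H.src (H.inv h) := by rw [H.src_inv, hm]
  rw [← Z.zs2 _ _ _ hk (G.src_inv g), ← Z.zs3 _ _ _ hk (G.src_inv g), G.inv_mul, hg,
    Z.act_unit_s8, Z.zs9, H.rng_inv, H.inv_mul]
  exact ⟨rfl, rfl⟩
end

section
/- Let 𝒦 be a groupoid and let 𝒢 and 𝒣 be subgroupoids of 𝒦 such that every arrow k of 𝒦 admits a unique factorization k = gh with g an arrow of 𝒢, h an arrow of 𝒣, and the source of g equal to the range of h. Then every identity arrow of 𝒦 belongs to both 𝒢 and 𝒣; in particular 𝒢 and 𝒣 are wide subgroupoids of 𝒦 and the unit spaces of 𝒦, 𝒢 and 𝒣 coincide. -/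
/-- Internal Zappa–Szép products, unit spaces: let `K` be a groupoid and `G`, `H`
subgroupoids of `K` (families of arrows closed under composition, whenever defined, and
under inverses) such that every arrow `k` of `K` admits a unique factorization `k = gh`
with `g ∈ G`, `h ∈ H` and the source of `g` equal to the range of `h`.  Then every
identity arrow of `K` belongs to both `G` and `H`; in particular `G` and `H` are wide
subgroupoids of `K` and the unit spaces of `K`, `G` and `H` coincide. -/
theorem internal_zs_units {U : Type*} (K : GroupoidOn U) (G H : Set K.Arr)
    (hGmul : ∀ g₁ g₂, g₁ ∈ G → g₂ ∈ G → K.src g₁ = K.rng g₂ → K.mul g₁ g₂ ∈ G)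
    (hGinv : ∀ g, g ∈ G → K.inv g ∈ G)
    (hHmul : ∀ h₁ h₂, h₁ ∈ H → h₂ ∈ H → K.src h₁ = K.rng h₂ → K.mul h₁ h₂ ∈ H)
    (hHinv : ∀ h, h ∈ H → K.inv h ∈ H)
    (huniq : ∀ k : K.Arr, ∃! p : K.Arr × K.Arr,
      p.1 ∈ G ∧ p.2 ∈ H ∧ K.src p.1 = K.rng p.2 ∧ k = K.mul p.1 p.2) :
    ∀ u : U, K.unit u ∈ G ∧ K.unit u ∈ H := by
  intro u
  obtain ⟨⟨g, h⟩, ⟨hg, hh, hsrc, hk⟩, -⟩ := huniq (K.unit u)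
  have hrng : K.rng g = u := by rw [← K.rng_mul g h hsrc, ← hk, K.rng_unit]
  have hsrc' : K.src h = u := by rw [← K.src_mul g h hsrc, ← hk, K.src_unit]
  constructor
  · have hunit := hGmul g (K.inv g) hg (hGinv g hg) (K.rng_inv g).symm
    rwa [K.mul_inv, hrng] at hunit
  · have hunit := hHmul (K.inv h) h (hHinv h hh) hh (K.src_inv h)
    rwa [K.inv_mul, hsrc'] at hunit
end

section
/- Let 𝒦 be a groupoid and let 𝒢 and 𝒣 be subgroupoids of 𝒦 such that every arrow k of 𝒦 admits a unique factorization k = gh with g an arrow of 𝒢, h an arrow of 𝒣, and the source of g equal to the range of h. For each pair of arrows h of 𝒣 and g of 𝒢 with the source of h equal to the range of g, let (h·g, h|_g) be the unique pair with h·g an arrow of 𝒢, h|_g an arrow of 𝒣, and hg = (h·g)(h|_g). Then, writing b and t for the range and source of arrows of 𝒢 and l and r for the range and source of arrows of 𝒣, these maps satisfy the Zappa–Szép axioms (ZS1)–(ZS9); moreover, the map (g,h) ↦ gh is a bijection from the set of composable pairs {(g,h) : g an arrow of 𝒢, h an arrow of 𝒣, t(g) = l(h)} onto the arrows of 𝒦,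 and it satisfies (g₁h₁)(g₂h₂) = (g₁(h₁·g₂))((h₁|_{g₂})h₂) whenever the left-hand side is defined; consequently 𝒦 is isomorphic to the Zappa–Szép product 𝒢⋈𝒣. -/
namespace GroupoidOn

variable {U : Type*} {K : GroupoidOn U}

/-- A composite of two composable pairs can be rebracketed around its middle product. -/
theorem mul_mul_mul_assoc {a b c d : K.Arr} (hab : K.src a = K.rng b)
    (hbc : K.src b = K.rng c) (hcd : K.src c = K.rng d) :
    K.mul (K.mul a b) (K.mul c d) = K.mul a (K.mul (K.mul b c) d) := by
  rw [K.mul_assoc a b _ hab (by rw [K.rng_mul c d hcd, hbc]), K.mul_assoc b c d hbc hcd]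

/-- If the unit at `u` factors as `gh`, with `g` and `h` in sets of arrows closed under
composition and inverses, then both sets contain that unit. -/
theorem unit_mem_of_mul_eq_unit {G H : Set K.Arr}
    (hG : ∀ g₁ g₂, g₁ ∈ G → g₂ ∈ G → K.src g₁ = K.rng g₂ → K.mul g₁ g₂ ∈ G)
    (hGinv : ∀ g, g ∈ G → K.inv g ∈ G)
    (hH : ∀ h₁ h₂, h₁ ∈ H → h₂ ∈ H → K.src h₁ = K.rng h₂ → K.mul h₁ h₂ ∈ H)
    (hHinv : ∀ h, h ∈ H → K.inv h ∈ H) {u : U} {g h : K.Arr} (hg : g ∈ G) (hh : h ∈ H)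
    (hgh : K.src g = K.rng h) (hu : K.unit u = K.mul g h) :
    K.unit u ∈ G ∧ K.unit u ∈ H := by
  have hr : K.rng g = u := by rw [← K.rng_mul g h hgh, ← hu, K.rng_unit]
  have hs : K.src h = u := by rw [← K.src_mul g h hgh, ← hu, K.src_unit]
  constructor
  · rw [← hr, ← K.mul_inv]
    exact hG _ _ hg (hGinv g hg) (K.rng_inv g).symm
  · rw [← hs, ← K.inv_mul]
    exact hH _ _ (hHinv h hh) hh (K.src_inv h)

end GroupoidOn

/-- Internal Zappa–Szép products: let `K` be a groupoid and `G`, `H` subgroupoids of `K`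
(families of arrows closed under composition, whenever defined, and under inverses) such
that every arrow `k` of `K` admits a unique factorization `k = gh` with `g ∈ G`, `h ∈ H`
and the source of `g` equal to the range of `h`.  For arrows `h ∈ H`, `g ∈ G` with the
source of `h` equal to the range of `g`, let `(act h g, res h g)` be the unique pair with
`act h g ∈ G`, `res h g ∈ H` and `hg = (act h g)(res h g)`.  Then these maps satisfy the
Zappa–Szép axioms (ZS1)–(ZS9); moreover `(g,h) ↦ gh` is a bijection from the set of
composable pairs `{(g,h) : g ∈ G, h ∈ H, t(g) = l(h)}` onto the arrows of `K`, and it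
satisfies `(g₁h₁)(g₂h₂) = (g₁(h₁·g₂))((h₁|_{g₂})h₂)` whenever the left-hand side is
defined; consequently `K` is isomorphic to the Zappa–Szép product `G ⋈ H`. -/
theorem internal_zs_product {U : Type*} (K : GroupoidOn U) (G H : Set K.Arr)
    (hGmul : ∀ g₁ g₂, g₁ ∈ G → g₂ ∈ G → K.src g₁ = K.rng g₂ → K.mul g₁ g₂ ∈ G)
    (hGinv : ∀ g, g ∈ G → K.inv g ∈ G)
    (hHmul : ∀ h₁ h₂, h₁ ∈ H → h₂ ∈ H → K.src h₁ = K.rng h₂ → K.mul h₁ h₂ ∈ H)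
    (hHinv : ∀ h, h ∈ H → K.inv h ∈ H)
    (huniq : ∀ k : K.Arr, ∃! p : K.Arr × K.Arr,
      p.1 ∈ G ∧ p.2 ∈ H ∧ K.src p.1 = K.rng p.2 ∧ k = K.mul p.1 p.2)
    (act res : K.Arr → K.Arr → K.Arr)
    (hfac : ∀ h g, h ∈ H → g ∈ G → K.src h = K.rng g →
      act h g ∈ G ∧ res h g ∈ H ∧ K.src (act h g) = K.rng (res h g) ∧
        K.mul h g = K.mul (act h g) (res h g)) :
    -- (ZS1)
    (∀ h₁ h₂ g, h₁ ∈ H → h₂ ∈ H → g ∈ G → K.src h₁ = K.rng h₂ → K.src h₂ = K.rng g →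
      act (K.mul h₁ h₂) g = act h₁ (act h₂ g))
    -- (ZS2)
    ∧ (∀ h g₁ g₂, h ∈ H → g₁ ∈ G → g₂ ∈ G → K.src h = K.rng g₁ → K.src g₁ = K.rng g₂ →
      act h (K.mul g₁ g₂) = K.mul (act h g₁) (act (res h g₁) g₂))
    -- (ZS3)
    ∧ (∀ h g₁ g₂, h ∈ H → g₁ ∈ G → g₂ ∈ G → K.src h = K.rng g₁ → K.src g₁ = K.rng g₂ →
      res h (K.mul g₁ g₂) = res (res h g₁) g₂)
    -- (ZS4)
    ∧ (∀ h₁ h₂ g, h₁ ∈ H → h₂ ∈ H → g ∈ G → K.src h₁ = K.rng h₂ → K.src h₂ = K.rng g →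
      res (K.mul h₁ h₂) g = K.mul (res h₁ (act h₂ g)) (res h₂ g))
    -- (ZS5)
    ∧ (∀ h g, h ∈ H → g ∈ G → K.src h = K.rng g → K.rng (act h g) = K.rng h)
    -- (ZS6)
    ∧ (∀ h g, h ∈ H → g ∈ G → K.src h = K.rng g → K.src (res h g) = K.src g)
    -- (ZS7)
    ∧ (∀ h g, h ∈ H → g ∈ G → K.src h = K.rng g → K.src (act h g) = K.rng (res h g))
    -- (ZS8)
    ∧ (∀ g, g ∈ G → act (K.unit (K.rng g)) g = g)
    -- (ZS9)
    ∧ (∀ h, h ∈ H → res h (K.unit (K.src h)) = h)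
    -- (g,h) ↦ gh is a bijection from G ⋈ H onto the arrows of K
    ∧ Function.Bijective
        (fun p : {p : K.Arr × K.Arr // p.1 ∈ G ∧ p.2 ∈ H ∧ K.src p.1 = K.rng p.2} =>
          K.mul p.1.1 p.1.2)
    -- (g,h) ↦ gh intertwines the multiplications: (g₁h₁)(g₂h₂) = (g₁(h₁·g₂))((h₁|_{g₂})h₂)
    ∧ (∀ g₁ h₁ g₂ h₂, g₁ ∈ G → h₁ ∈ H → g₂ ∈ G → h₂ ∈ H →
        K.src g₁ = K.rng h₁ → K.src g₂ = K.rng h₂ → K.src h₁ = K.rng g₂ →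
        K.mul (K.mul g₁ h₁) (K.mul g₂ h₂)
          = K.mul (K.mul g₁ (act h₁ g₂)) (K.mul (res h₁ g₂) h₂)) := by
  have uniq : ∀ {a b a' b' : K.Arr}, a ∈ G → b ∈ H → K.src a = K.rng b →
      a' ∈ G → b' ∈ H → K.src a' = K.rng b' → K.mul a b = K.mul a' b' → a = a' ∧ b = b' := by
    intro a b a' b' ha hb hab ha' hb' hab' h
    have := (huniq (K.mul a b)).unique (y₁ := (a, b)) (y₂ := (a', b'))
      ⟨ha, hb, hab, rfl⟩ ⟨ha', hb', hab', h⟩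
    exact ⟨congrArg Prod.fst this, congrArg Prod.snd this⟩
  have units : ∀ u, K.unit u ∈ G ∧ K.unit u ∈ H := fun u => by
    obtain ⟨p, ⟨hp₁, hp₂, hp, hu⟩, -⟩ := huniq (K.unit u)
    exact GroupoidOn.unit_mem_of_mul_eq_unit hGmul hGinv hHmul hHinv hp₁ hp₂ hp hu
  have rng_act : ∀ h g, h ∈ H → g ∈ G → K.src h = K.rng g → K.rng (act h g) = K.rng h := by
    intro h g hh hg hc
    obtain ⟨-, -, h₃, h₄⟩ := hfac h g hh hg hc
    rw [← K.rng_mul _ _ h₃, ← h₄, K.rng_mul _ _ hc]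
  have src_res : ∀ h g, h ∈ H → g ∈ G → K.src h = K.rng g → K.src (res h g) = K.src g := by
    intro h g hh hg hc
    obtain ⟨-, -, h₃, h₄⟩ := hfac h g hh hg hc
    rw [← K.src_mul _ _ h₃, ← h₄, K.src_mul _ _ hc]
  have mul_left : ∀ h₁ h₂ g, h₁ ∈ H → h₂ ∈ H → g ∈ G → K.src h₁ = K.rng h₂ →
      K.src h₂ = K.rng g → act (K.mul h₁ h₂) g = act h₁ (act h₂ g) ∧
        res (K.mul h₁ h₂) g = K.mul (res h₁ (act h₂ g)) (res h₂ g) := by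
    intro h₁ h₂ g hh₁ hh₂ hg hc hc'
    obtain ⟨a₁, a₂, a₃, a₄⟩ := hfac h₂ g hh₂ hg hc'
    have hca : K.src h₁ = K.rng (act h₂ g) := hc.trans (rng_act h₂ g hh₂ hg hc').symm
    obtain ⟨b₁, b₂, b₃, b₄⟩ := hfac h₁ (act h₂ g) hh₁ a₁ hca
    obtain ⟨c₁, c₂, c₃, c₄⟩ := hfac (K.mul h₁ h₂) g (hHmul _ _ hh₁ hh₂ hc) hg
      ((K.src_mul _ _ hc).trans hc')
    have hcr : K.src (res h₁ (act h₂ g)) = K.rng (res h₂ g) :=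
      (src_res _ _ hh₁ a₁ hca).trans a₃
    refine uniq c₁ c₂ c₃ b₁ (hHmul _ _ b₂ a₂ hcr) (b₃.trans (K.rng_mul _ _ hcr).symm) ?_
    rw [← c₄, K.mul_assoc _ _ _ hc hc', a₄, ← K.mul_assoc _ _ _ hca a₃, b₄,
      K.mul_assoc _ _ _ b₃ hcr]
  have mul_right : ∀ h g₁ g₂, h ∈ H → g₁ ∈ G → g₂ ∈ G → K.src h = K.rng g₁ →
      K.src g₁ = K.rng g₂ → act h (K.mul g₁ g₂) = K.mul (act h g₁) (act (res h g₁) g₂) ∧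
        res h (K.mul g₁ g₂) = res (res h g₁) g₂ := by
    intro h g₁ g₂ hh hg₁ hg₂ hc hc'
    obtain ⟨a₁, a₂, a₃, a₄⟩ := hfac h g₁ hh hg₁ hc
    have hcr : K.src (res h g₁) = K.rng g₂ := (src_res h g₁ hh hg₁ hc).trans hc'
    obtain ⟨b₁, b₂, b₃, b₄⟩ := hfac (res h g₁) g₂ a₂ hg₂ hcr
    obtain ⟨c₁, c₂, c₃, c₄⟩ := hfac h (K.mul g₁ g₂) hh (hGmul _ _ hg₁ hg₂ hc')
      (hc.trans (K.rng_mul _ _ hc').symm)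
    have hca : K.src (act h g₁) = K.rng (act (res h g₁) g₂) :=
      a₃.trans (rng_act _ _ a₂ hg₂ hcr).symm
    refine uniq c₁ c₂ c₃ (hGmul _ _ a₁ b₁ hca) b₂ ((K.src_mul _ _ hca).trans b₃) ?_
    rw [← c₄, ← K.mul_assoc _ _ _ hc hc', a₄, K.mul_assoc _ _ _ a₃ hcr, b₄,
      ← K.mul_assoc _ _ _ hca b₃]
  refine ⟨fun h₁ h₂ g hh₁ hh₂ hg hc hc' => (mul_left h₁ h₂ g hh₁ hh₂ hg hc hc').1,
    fun h g₁ g₂ hh hg₁ hg₂ hc hc' => (mul_right h g₁ g₂ hh hg₁ hg₂ hc hc').1,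
    fun h g₁ g₂ hh hg₁ hg₂ hc hc' => (mul_right h g₁ g₂ hh hg₁ hg₂ hc hc').2,
    fun h₁ h₂ g hh₁ hh₂ hg hc hc' => (mul_left h₁ h₂ g hh₁ hh₂ hg hc hc').2,
    rng_act, src_res, fun h g hh hg hc => (hfac h g hh hg hc).2.2.1, ?_, ?_, ⟨?_, ?_⟩, ?_⟩
  · intro g hg
    obtain ⟨c₁, c₂, c₃, c₄⟩ := hfac _ g (units (K.rng g)).2 hg (K.src_unit _)
    refine (uniq c₁ c₂ c₃ hg (units (K.src g)).2 (K.rng_unit _).symm ?_).1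
    rw [← c₄, K.unit_mul, K.mul_unit]
  · intro h hh
    obtain ⟨c₁, c₂, c₃, c₄⟩ := hfac h _ hh (units (K.src h)).1 (K.rng_unit _).symm
    refine (uniq c₁ c₂ c₃ (units (K.rng h)).1 hh (K.src_unit _) ?_).2
    rw [← c₄, K.unit_mul, K.mul_unit]
  · rintro ⟨⟨a, b⟩, ha, hb, hab⟩ ⟨⟨a', b'⟩, ha', hb', hab'⟩ h
    obtain ⟨rfl, rfl⟩ := uniq ha hb hab ha' hb' hab' h
    rfl
  · intro k
    obtain ⟨p, ⟨hp₁, hp₂, hp, hk⟩, -⟩ := huniq k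
    exact ⟨⟨p, hp₁, hp₂, hp⟩, hk.symm⟩
  · intro g₁ h₁ g₂ h₂ hg₁ hh₁ hg₂ hh₂ hc₁ hc₂ hc
    obtain ⟨-, -, a₃, a₄⟩ := hfac h₁ g₂ hh₁ hg₂ hc
    rw [GroupoidOn.mul_mul_mul_assoc hc₁ hc hc₂, a₄,
      GroupoidOn.mul_mul_mul_assoc (hc₁.trans (rng_act _ _ hh₁ hg₂ hc).symm) a₃
        ((src_res _ _ hh₁ hg₂ hc).trans hc₂)]
end

section
/- Let C be a C*-algebra and let A and B be closed *-subalgebras of C. Write AB for the closed linear span of {ab : a ∈ A, b ∈ B} and BA for the closed linear span of {ba : b ∈ B, a ∈ A}. Then AB = BA if and only if AB is a C*-subalgebra of C, i.e., AB is closed under multiplication and under the adjoint operation. -/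
open Set Submodule in
/-- The adjoint maps the closed span of `S * T` into the closed span of `T * S`, for
self-adjoint sets `S` and `T`. -/
theorem star_mem_closure_span_image2_mul
    {C : Type*} [NonUnitalRing C] [StarRing C] [TopologicalSpace C] [ContinuousStar C]
    [Module ℂ C] [StarModule ℂ C] {S T : Set C}
    (hS : ∀ s ∈ S, star s ∈ S) (hT : ∀ t ∈ T, star t ∈ T) {x : C}
    (hx : x ∈ closure (span ℂ (image2 (· * ·) S T) : Set C)) :
    star x ∈ closure (span ℂ (image2 (· * ·) T S) : Set C) := by
  refine map_mem_closure continuous_star hx fun y hy => ?_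
  induction hy using span_induction with
  | mem y hy =>
    obtain ⟨s, hs, t, ht, rfl⟩ := hy
    exact subset_span ⟨star t, hT t ht, star s, hS s hs, (star_mul s t).symm⟩
  | zero => simp
  | add y z _ _ hy hz => simpa only [SetLike.mem_coe, star_add] using add_mem hy hz
  | smul c y _ hy => simpa only [SetLike.mem_coe, star_smul] using smul_mem _ (star c) hy

open Set Submodule in
/-- If the closed span of `S * T` contains `T * S`, and `S` and `T` are closed under
multiplication, then the closed span of `S * T` is closed under multiplication. -/
theorem mul_mem_closure_span_image2_mul
    {C : Type*} [NonUnitalRing C] [TopologicalSpace C] [IsTopologicalRing C]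
    [Module ℂ C] [ContinuousConstSMul ℂ C] [IsScalarTower ℂ C C] [SMulCommClass ℂ C C]
    {S T : Set C}
    (hS : ∀ s ∈ S, ∀ s' ∈ S, s * s' ∈ S) (hT : ∀ t ∈ T, ∀ t' ∈ T, t * t' ∈ T)
    (hTS : ∀ t ∈ T, ∀ s ∈ S, t * s ∈ closure (span ℂ (image2 (· * ·) S T) : Set C))
    {x y : C}
    (hx : x ∈ closure (span ℂ (image2 (· * ·) S T) : Set C))
    (hy : y ∈ closure (span ℂ (image2 (· * ·) S T) : Set C)) :
    x * y ∈ closure (span ℂ (image2 (· * ·) S T) : Set C) := by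
  have sandwich : ∀ s ∈ S, ∀ t ∈ T, ∀ z ∈ closure (span ℂ (image2 (· * ·) S T) : Set C),
      s * z * t ∈ closure (span ℂ (image2 (· * ·) S T) : Set C) := by
    intro s hs t ht z hz
    refine map_mem_closure (f := fun z => s * z * t) (by fun_prop) hz fun w hw => ?_
    induction hw using span_induction with
    | mem w hw =>
      obtain ⟨s', hs', t', ht', rfl⟩ := hw
      exact subset_span ⟨s * s', hS s hs s' hs', t' * t, hT t' ht' t ht, by
        simp only [mul_assoc]⟩
    | zero => simp
    | add w w' _ _ hw hw' => simpa only [SetLike.mem_coe, mul_add, add_mul] using add_mem hw hw'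
    | smul c w _ hw =>
      simpa only [SetLike.mem_coe, mul_smul_comm, smul_mul_assoc] using smul_mem _ c hw
  rw [← closure_closure]
  refine map_mem_closure₂ continuous_mul hx hy fun v hv w hw => ?_
  change v * w ∈ (span ℂ (image2 (· * ·) S T)).topologicalClosure
  induction hv, hw using span_induction₂ with
  | mem_mem v w hv hw =>
    obtain ⟨s, hs, t, ht, rfl⟩ := hv
    obtain ⟨s', hs', t', ht', rfl⟩ := hw
    have h := sandwich s hs t' ht' (t * s') (hTS t ht s' hs')
    simp only [mul_assoc] at h ⊢
    exact h
  | zero_left => simp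
  | zero_right => simp
  | add_left _ _ _ _ _ _ h h' => simpa only [add_mul] using add_mem h h'
  | add_right _ _ _ _ _ _ h h' => simpa only [mul_add] using add_mem h h'
  | smul_left c _ _ _ _ h => simpa only [smul_mul_assoc] using smul_mem _ c h
  | smul_right c _ _ _ _ h => simpa only [mul_smul_comm] using smul_mem _ c h


/-- Let `C` be a (not necessarily unital) C*-algebra and `A`, `B` closed *-subalgebras
of `C`.  Writing `AB` for the closed linear span of `{ab : a ∈ A, b ∈ B}`, and `BA` for
the closed linear span of `{ba : b ∈ B, a ∈ A}`, one has `AB = BA` if and only if `AB`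
is a C*-subalgebra of `C`, i.e. `AB` is closed under multiplication and under the
adjoint operation. -/
theorem closedSpan_mul_comm_iff_cstar
    {C : Type*} [NonUnitalNormedRing C] [StarRing C] [CStarRing C]
    [NormedSpace ℂ C] [IsScalarTower ℂ C C] [SMulCommClass ℂ C C]
    [StarModule ℂ C] [CompleteSpace C]
    (A B : NonUnitalStarSubalgebra ℂ C)
    (hA : IsClosed (A : Set C)) (hB : IsClosed (B : Set C)) :
    closure (Submodule.span ℂ (Set.image2 (· * ·) (A : Set C) (B : Set C)) : Set C)
        = closure (Submodule.span ℂ (Set.image2 (· * ·) (B : Set C) (A : Set C)) : Set C)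
      ↔ ((∀ x ∈ closure
              (Submodule.span ℂ (Set.image2 (· * ·) (A : Set C) (B : Set C)) : Set C),
            ∀ y ∈ closure
              (Submodule.span ℂ (Set.image2 (· * ·) (A : Set C) (B : Set C)) : Set C),
            x * y ∈ closure
              (Submodule.span ℂ (Set.image2 (· * ·) (A : Set C) (B : Set C)) : Set C))
        ∧ (∀ x ∈ closure
              (Submodule.span ℂ (Set.image2 (· * ·) (A : Set C) (B : Set C)) : Set C),
            star x ∈ closure
              (Submodule.span ℂ (Set.image2 (· * ·) (A : Set C) (B : Set C)) : Set C))) := by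
  have starA : ∀ a ∈ (A : Set C), star a ∈ (A : Set C) := fun _ => star_mem
  have starB : ∀ b ∈ (B : Set C), star b ∈ (B : Set C) := fun _ => star_mem
  constructor
  · intro h
    refine ⟨fun x hx y hy => mul_mem_closure_span_image2_mul (fun _ ha _ ha' => mul_mem ha ha')
      (fun _ hb _ hb' => mul_mem hb hb') (fun b hb a ha => ?_) hx hy, fun x hx => ?_⟩
    · rw [h]
      exact subset_closure (Submodule.subset_span ⟨b, hb, a, ha, rfl⟩)
    · rw [h]
      exact star_mem_closure_span_image2_mul starA starB hx
  · rintro ⟨-, h⟩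
    refine Set.Subset.antisymm (fun x hx => ?_) (fun x hx => ?_)
    · simpa only [star_star] using star_mem_closure_span_image2_mul starA starB (h x hx)
    · simpa only [star_star] using h _ (star_mem_closure_span_image2_mul starB starA hx)
end

section
/- Let X be a set and let S, T : X → X be commuting maps (S ∘ T = T ∘ S) which *-commute, i.e., for all x, y ∈ X with T x = S y there exists a unique z ∈ X with S z = x and T z = y. Then for all m, n ∈ ℕ the maps S^m and T^n *-commute: for all x, y ∈ X with T^n x = S^m y there exists a unique z ∈ X with S^m z = x and T^n z = y. -/
/-- If commuting maps `A` and `B` *-commute, then so do `A^[m]` and `B`. -/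
theorem star_commute_iterate_left {X : Type*} {A B : X → X} (hcomm : Function.Commute A B)
    (hstar : ∀ x y : X, B x = A y → ∃! z : X, A z = x ∧ B z = y) (m : ℕ) :
    ∀ x y : X, B x = A^[m] y → ∃! z : X, A^[m] z = x ∧ B z = y := by
  induction m with
  | zero => exact fun x y h => ⟨x, ⟨rfl, h⟩, fun z hz => hz.1⟩
  | succ m ih =>
    intro x y h
    obtain ⟨w, ⟨hwx, hwy⟩, hw⟩ := ih x (A y) h
    obtain ⟨z, ⟨hzw, hzy⟩, hz⟩ := hstar w y hwy
    refine ⟨z, ⟨by rw [Function.iterate_succ_apply, hzw, hwx], hzy⟩, fun v hv => ?_⟩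
    exact hz v ⟨hw (A v) ⟨hv.1, by rw [← hcomm v, hv.2]⟩, hv.2⟩

/-- The *-commuting property is symmetric in the two maps. -/
theorem star_commute_symm {X : Type*} {A B : X → X}
    (hstar : ∀ x y : X, B x = A y → ∃! z : X, A z = x ∧ B z = y) :
    ∀ x y : X, A x = B y → ∃! z : X, B z = x ∧ A z = y :=
  fun x y h => by simpa only [and_comm] using hstar y x h.symm

/-- Let `X` be a set and `S`, `T : X → X` commuting maps which *-commute, i.e. for all
`x, y ∈ X` with `T x = S y` there is a unique `z ∈ X` with `S z = x` and `T z = y`.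
Then for all `m, n ∈ ℕ` the maps `S^m` and `T^n` *-commute: for all `x, y ∈ X` with
`T^n x = S^m y` there is a unique `z ∈ X` with `S^m z = x` and `T^n z = y`. -/
theorem star_commute_iterate {X : Type*} (S T : X → X)
    (hcomm : S ∘ T = T ∘ S)
    (hstar : ∀ x y : X, T x = S y → ∃! z : X, S z = x ∧ T z = y) :
    ∀ m n : ℕ, ∀ x y : X, T^[n] x = S^[m] y →
      ∃! z : X, S^[m] z = x ∧ T^[n] z = y := by
  intro m n
  have hST : Function.Commute S T := congrFun hcomm
  exact star_commute_symm (star_commute_iterate_left (hST.iterate_left m).symm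
    (star_commute_symm (star_commute_iterate_left hST hstar m)) n)
end

section
/- Let 𝒢 be a groupoid with object set 𝒢⁰, A a group, and c a map assigning to each arrow of 𝒢 an element of A such that c(g₁g₂) = c(g₁)c(g₂) whenever the product g₁g₂ is defined. Then the formula β·(u,α) = (u,αβ⁻¹) defines a left action of A on 𝒢⁰ × A, and the maps (β,(b(g),α))·(g,α) := (g, αβ⁻¹) and (β,(b(g),α))|_{(g,α)} := (c(g)⁻¹βc(g), (t(g), αc(g))), defined for arrows (β,(u,α')) of the transformation groupoid ℋ = A ⋉ (𝒢⁰ × A) and arrows (g,α) of the skew-product groupoid 𝒢(c) with r(β,(u,α')) = b(g,α) (i.e., (u,α') = (b(g),α)), satisfy the Zappa–Szép axioms (ZS1)–(ZS9) for the pair of groupoids (𝒢(c), ℋ) with common object set 𝒢⁰ × A, and hence induce a Zappa–Szép product groupoid 𝒢(c) ⋈ ℋ. -/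
section SkewProduct

variable {U : Type*} (K : GroupoidOn U) {A : Type*} [Group A] (c : K.Arr → A)

/-- Range `b(g,α) = (b(g), α)` of an arrow of the skew-product groupoid `K(c)`. -/
def skewB (p : K.Arr × A) : U × A := (K.rng p.1, p.2)

/-- Source `t(g,α) = (t(g), α c(g))` of an arrow of the skew-product groupoid `K(c)`. -/
def skewT (p : K.Arr × A) : U × A := (K.src p.1, p.2 * c p.1)

/-- Multiplication `(g,α)(h,αc(g)) = (gh, α)` in the skew-product groupoid `K(c)`
(defined when `t(g,α) = b(h,β)`). -/
def skewMul (p q : K.Arr × A) : K.Arr × A := (K.mul p.1 q.1, p.2)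

/-- Identity arrow `(u, α) ↦ (unit u, α)` of the skew-product groupoid `K(c)`. -/
def skewUnit (x : U × A) : K.Arr × A := (K.unit x.1, x.2)

/-- The left action `β·(u,α) = (u, αβ⁻¹)` of `A` on the object set `K⁰ × A`. -/
def trAct (β : A) (x : U × A) : U × A := (x.1, x.2 * β⁻¹)

/-- Range `l(β,x) = β·x` of an arrow of the transformation groupoid `A ⋉ (K⁰ × A)`. -/
def trL (h : A × (U × A)) : U × A := (h.2.1, h.2.2 * h.1⁻¹)

/-- Source `r(β,x) = x` of an arrow of the transformation groupoid `A ⋉ (K⁰ × A)`. -/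
def trR (h : A × (U × A)) : U × A := h.2

/-- Multiplication `(β', β·x)(β, x) = (β'β, x)` in the transformation groupoid
`A ⋉ (K⁰ × A)` (defined when `r(β',y) = l(β,x)`). -/
def trMul (h₁ h₂ : A × (U × A)) : A × (U × A) := (h₁.1 * h₂.1, h₂.2)

/-- Identity arrow `x ↦ (1, x)` of the transformation groupoid `A ⋉ (K⁰ × A)`. -/
def trUnit (x : U × A) : A × (U × A) := ((1 : A), x)

/-- The Zappa–Szép action map `(β,(b(g),α))·(g,α) := (g, αβ⁻¹)`. -/
def zAct (h : A × (U × A)) (p : K.Arr × A) : K.Arr × A := (p.1, p.2 * h.1⁻¹)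

/-- The Zappa–Szép restriction map
`(β,(b(g),α))|_{(g,α)} := (c(g)⁻¹ β c(g), (t(g), αc(g)))`. -/
def zRes (h : A × (U × A)) (p : K.Arr × A) : A × (U × A) :=
  ((c p.1)⁻¹ * h.1 * c p.1, (K.src p.1, p.2 * c p.1))

/-- Let `K` be a groupoid with object set `U`, `A` a group, and `c` a map on arrows of
`K` with `c(g₁g₂) = c(g₁)c(g₂)` whenever `g₁g₂` is defined.  Then
`β·(u,α) = (u,αβ⁻¹)` defines a left action of `A` on `U × A`, and the maps
`(β,(b(g),α))·(g,α) := (g, αβ⁻¹)` and `(β,(b(g),α))|_{(g,α)} := (c(g)⁻¹βc(g), (t(g), αc(g)))`,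
defined for arrows of the transformation groupoid `H = A ⋉ (U × A)` and arrows of the
skew-product groupoid `K(c)` with `r(β,(u,α')) = b(g,α)`, satisfy the Zappa–Szép axioms
(ZS1)–(ZS9) for the pair of groupoids `(K(c), H)` with common object set `U × A`, and
hence induce a Zappa–Szép product groupoid `K(c) ⋈ H`. -/
theorem skew_product_zappa_szep
    (hc : ∀ g₁ g₂, K.src g₁ = K.rng g₂ → c (K.mul g₁ g₂) = c g₁ * c g₂) :
    -- `β·(u,α) = (u,αβ⁻¹)` is a left action of `A` on `U × A`
    (∀ x : U × A, trAct (1 : A) x = x)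
    ∧ (∀ (β β' : A) (x : U × A),
        trAct β' (trAct β x) = trAct (β' * β) x)
    -- (ZS1)
    ∧ (∀ (h₁ h₂ : A × (U × A)) (g : K.Arr × A),
        trR h₁ = trL h₂ → trR h₂ = skewB K g →
        zAct K (trMul h₁ h₂) g = zAct K h₁ (zAct K h₂ g))
    -- (ZS2)
    ∧ (∀ (h : A × (U × A)) (g₁ g₂ : K.Arr × A),
        trR h = skewB K g₁ → skewT K c g₁ = skewB K g₂ →
        zAct K h (skewMul K g₁ g₂) = skewMul K (zAct K h g₁) (zAct K (zRes K c h g₁) g₂))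
    -- (ZS3)
    ∧ (∀ (h : A × (U × A)) (g₁ g₂ : K.Arr × A),
        trR h = skewB K g₁ → skewT K c g₁ = skewB K g₂ →
        zRes K c h (skewMul K g₁ g₂) = zRes K c (zRes K c h g₁) g₂)
    -- (ZS4)
    ∧ (∀ (h₁ h₂ : A × (U × A)) (g : K.Arr × A),
        trR h₁ = trL h₂ → trR h₂ = skewB K g →
        zRes K c (trMul h₁ h₂) g
          = trMul (zRes K c h₁ (zAct K h₂ g)) (zRes K c h₂ g))
    -- (ZS5)
    ∧ (∀ (h : A × (U × A)) (g : K.Arr × A), trR h = skewB K g →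
        skewB K (zAct K h g) = trL h)
    -- (ZS6)
    ∧ (∀ (h : A × (U × A)) (g : K.Arr × A), trR h = skewB K g →
        trR (zRes K c h g) = skewT K c g)
    -- (ZS7)
    ∧ (∀ (h : A × (U × A)) (g : K.Arr × A), trR h = skewB K g →
        skewT K c (zAct K h g) = trL (zRes K c h g))
    -- (ZS8)
    ∧ (∀ g : K.Arr × A, zAct K (trUnit (skewB K g)) g = g)
    -- (ZS9)
    ∧ (∀ h : A × (U × A), zRes K c h (skewUnit K (trR h)) = h) := by
  have hunit : ∀ u, c (K.unit u) = 1 := fun u => by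
    have h := hc (K.unit u) (K.unit u) (by rw [K.src_unit, K.rng_unit])
    have hmul : K.mul (K.unit u) (K.unit u) = K.unit u := by
      simpa only [K.rng_unit] using K.unit_mul (K.unit u)
    rw [hmul] at h
    exact left_eq_mul.mp h
  refine ⟨?_, ?_, ?_, ?_, ?_, ?_, ?_, ?_, ?_, ?_, ?_⟩
  · simp [trAct]
  · simp [trAct, mul_assoc]
  · simp [zAct, trMul, mul_assoc]
  · simp [zAct, skewMul]
  · rintro h ⟨g₁, α₁⟩ ⟨g₂, α₂⟩ - hg
    simp only [skewT, skewB, Prod.mk.injEq] at hg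
    obtain ⟨hcomp, rfl⟩ := hg
    simp [zRes, skewMul, hc g₁ g₂ hcomp, K.src_mul g₁ g₂ hcomp, mul_assoc]
  · simp [zRes, zAct, trMul, mul_assoc]
  · intro h g hg
    simp_all [trR, skewB, zAct, trL]
  · simp [trR, zRes, skewT]
  · simp [skewT, zAct, trL, zRes, mul_assoc]
  · simp [zAct, trUnit]
  · simp [zRes, skewUnit, trR, hunit, K.src_unit]

end SkewProduct
end
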